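/- Fix δ > 0, β > 0 and χ ∈ [0, 1]. For every binary qubit POVM in conical coordinates (w, λ, θ, φ) with sinθ = χ, the Fisher information satisfies F_β ≤ 2δ²(1 − χ²) / (4 − χ² + 4 cosh(βδ) + χ² cosh(2βδ)), and equality holds when w = 1/2, λ = 1 and cosθ = √(1 − χ²). -/

import Mathlib

open Matrix ComplexOrder Real

noncomputable def pauliX : Matrix (Fin 2) (Fin 2) ℂ := !![0, 1; 1, 0]
noncomputable def pauliY : Matrix (Fin 2) (Fin 2) ℂ := !![0, -Complex.I; Complex.I, 0]
noncomputable def pauliZ : Matrix (Fin 2) (Fin 2) ℂ := !![1, 0; 0, -1]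

/-- The thermal qubit state `ρ_β = diag(e^{−βδ/2}, e^{βδ/2})/(2 cosh(βδ/2))`. -/
noncomputable def rhoTherm (δ β : ℝ) : Matrix (Fin 2) (Fin 2) ℂ :=
  ((2 * Real.cosh (β * δ / 2) : ℝ)⁻¹ : ℂ) •
    !![Complex.exp (-(β * δ / 2)), 0; 0, Complex.exp (β * δ / 2)]

/-- The POVM element `Π₀` of a binary qubit POVM in conical coordinates. -/
noncomputable def povm0 (w l θ φ : ℝ) : Matrix (Fin 2) (Fin 2) ℂ :=
  (w : ℂ) • ((1 : Matrix (Fin 2) (Fin 2) ℂ)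
    + ((l * Real.sin θ * Real.cos φ : ℝ) : ℂ) • pauliX
    + ((l * Real.sin θ * Real.sin φ : ℝ) : ℂ) • pauliY
    + ((l * Real.cos θ : ℝ) : ℂ) • pauliZ)

/-- The POVM element `Π₁ = I₂ − Π₀`. -/
noncomputable def povm1 (w l θ φ : ℝ) : Matrix (Fin 2) (Fin 2) ℂ :=
  1 - povm0 w l θ φ

/-- The outcome probability `p₀(β) = tr(ρ_β Π₀)`. -/
noncomputable def prob0 (δ β w l θ φ : ℝ) : ℝ :=
  ((rhoTherm δ β * povm0 w l θ φ).trace).re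

/-- The Fisher information of the measurement, `F_β = (dp₀/dβ)²/(p₀ p₁)`. -/
noncomputable def fisherInfo (δ β w l θ φ : ℝ) : ℝ :=
  (deriv (fun b => prob0 δ b w l θ φ) β) ^ 2 /
    (prob0 δ β w l θ φ * (1 - prob0 δ β w l θ φ))

theorem prob0_eq (δ β w l θ φ : ℝ) :
    prob0 δ β w l θ φ = w * (1 - l * Real.cos θ * Real.tanh (β * δ / 2)) := by
  have hC := (Real.cosh_pos (β * δ / 2)).ne'
  have hρ : rhoTherm δ β = !![(((2 * Real.cosh (β * δ / 2))⁻¹ * Real.exp (-(β * δ / 2)) : ℝ) : ℂ), 0;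
      0, (((2 * Real.cosh (β * δ / 2))⁻¹ * Real.exp (β * δ / 2) : ℝ) : ℂ)] := by
    ext i j
    fin_cases i <;> fin_cases j <;> simp [rhoTherm]
  have hpovm₀ : povm0 w l θ φ 0 0 = ((w * (1 + l * Real.cos θ) : ℝ) : ℂ) := by
    simp [povm0, pauliX, pauliY, pauliZ]
  have hpovm₁ : povm0 w l θ φ 1 1 = ((w * (1 - l * Real.cos θ) : ℝ) : ℂ) := by
    simp [povm0, pauliX, pauliY, pauliZ, sub_eq_add_neg]
  have htrace : prob0 δ β w l θ φ =
      (2 * Real.cosh (β * δ / 2))⁻¹ * Real.exp (-(β * δ / 2)) * (w * (1 + l * Real.cos θ)) +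
      (2 * Real.cosh (β * δ / 2))⁻¹ * Real.exp (β * δ / 2) * (w * (1 - l * Real.cos θ)) := by
    simp only [prob0, hρ, Matrix.trace_fin_two, Matrix.mul_apply, Fin.sum_univ_two, hpovm₀, hpovm₁,
      Matrix.of_apply, Matrix.cons_val', Matrix.cons_val_zero, Matrix.cons_val_one,
      Matrix.cons_val_fin_one, zero_mul, add_zero, zero_add, ← Complex.ofReal_mul,
      ← Complex.ofReal_add, Complex.ofReal_re]
  rw [htrace, ← Real.cosh_sub_sinh, ← Real.cosh_add_sinh, Real.tanh_eq_sinh_div_cosh]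
  field_simp
  ring

theorem hasDerivAt_prob0 (δ β w l θ φ : ℝ) :
    HasDerivAt (fun b => prob0 δ b w l θ φ)
      (-(w * (l * Real.cos θ) * δ / (2 * Real.cosh (β * δ / 2) ^ 2))) β := by
  have hC := (Real.cosh_pos (β * δ / 2)).ne'
  have hx : HasDerivAt (fun b : ℝ => b * δ / 2) (δ / 2) β := by
    simpa using ((hasDerivAt_id β).mul_const δ).div_const 2
  simp only [prob0_eq, Real.tanh_eq_sinh_div_cosh]
  refine ((((hx.sinh.div hx.cosh hC).const_mul (l * Real.cos θ)).const_sub 1).const_mul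
    w).congr_deriv ?_
  have h := Real.cosh_sq (β * δ / 2)
  field_simp
  linear_combination -(w * l * Real.cos θ * δ) * h

theorem fisherInfo_eq (δ β w l θ φ : ℝ) (hw : w ≠ 0) :
    fisherInfo δ β w l θ φ =
      δ ^ 2 / (4 * Real.cosh (β * δ / 2) ^ 4) *
        (w * (l * Real.cos θ) ^ 2 / ((1 - l * Real.cos θ * Real.tanh (β * δ / 2)) *
          (1 - w * (1 - l * Real.cos θ * Real.tanh (β * δ / 2))))) := by
  rw [fisherInfo, (hasDerivAt_prob0 δ β w l θ φ).deriv, prob0_eq]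
  generalize 1 - l * Real.cos θ * Real.tanh (β * δ / 2) = a
  rw [show w * a * (1 - w * a) = w * (a * (1 - w * a)) by ring, ← div_div,
    div_mul_div_comm, ← div_div (δ ^ 2 * _)]
  congr 1
  field_simp
  norm_num

theorem thermal_denominator_eq (x k : ℝ) :
    4 - k + 4 * Real.cosh (2 * x) + k * Real.cosh (4 * x) =
      8 * Real.cosh x ^ 4 * (1 - (1 - k) * Real.tanh x ^ 2) := by
  have hC := (Real.cosh_pos x).ne'
  rw [show 4 * x = 2 * (2 * x) by ring, Real.cosh_two_mul (2 * x), Real.sinh_two_mul,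
    Real.cosh_two_mul, Real.tanh_eq_sinh_div_cosh]
  field_simp
  rw [Real.sinh_sq]
  ring

theorem fisher_bound_eq (δ β k : ℝ) :
    2 * δ ^ 2 * (1 - k) /
        (4 - k + 4 * Real.cosh (β * δ) + k * Real.cosh (2 * β * δ)) =
      δ ^ 2 / (4 * Real.cosh (β * δ / 2) ^ 4) *
        ((1 - k) / (1 - (1 - k) * Real.tanh (β * δ / 2) ^ 2)) := by
  have h := thermal_denominator_eq (β * δ / 2) k
  rw [show 2 * (β * δ / 2) = β * δ by ring, show 4 * (β * δ / 2) = 2 * β * δ by ring] at h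
  rw [h, div_mul_div_comm, show 2 * δ ^ 2 * (1 - k) = 2 * (δ ^ 2 * (1 - k)) by ring,
    show ∀ y z : ℝ, 8 * y * z = 2 * (4 * y * z) by intros; ring,
    mul_div_mul_left _ _ two_ne_zero]

theorem binary_ratio_le {w m q t : ℝ} (hw : 0 < w) (hw' : w ≤ 1 / 2) (hmq : m ^ 2 ≤ q)
    (hq : q ≤ 1) (ht : t ^ 2 < 1) :
    w * m ^ 2 / ((1 - m * t) * (1 - w * (1 - m * t))) ≤ q / (1 - q * t ^ 2) := by
  have hqt : q * t ^ 2 < 1 := by nlinarith [sq_nonneg t]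
  have hmt : (m * t) ^ 2 < 1 := by nlinarith [sq_nonneg t]
  obtain ⟨hl, hu⟩ := abs_lt.mp ((sq_lt_one_iff_abs_lt_one _).mp hmt)
  have ha : 0 < 1 - m * t := by linarith
  have hb : 0 < 1 - w * (1 - m * t) := by nlinarith
  calc w * m ^ 2 / ((1 - m * t) * (1 - w * (1 - m * t)))
      ≤ m ^ 2 / (1 - m ^ 2 * t ^ 2) := by
        rw [div_le_div_iff₀ (mul_pos ha hb) (by nlinarith)]
        have h : 0 ≤ m ^ 2 * (1 - m * t) * (1 - 2 * w) :=
          mul_nonneg (mul_nonneg (sq_nonneg m) ha.le) (by linarith)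
        linear_combination h
    _ ≤ q / (1 - q * t ^ 2) := by
        rw [div_le_div_iff₀ (by nlinarith) (by linarith)]
        linear_combination hmq

/-- For fixed non-commutativity `χ = sin θ`, the Fisher information is maximized by a
projective POVM: it is bounded by `2δ²(1−χ²)/(4−χ²+4cosh(βδ)+χ²cosh(2βδ))`, with
equality when `w = 1/2`, `λ = 1`, `cos θ = √(1−χ²)`. -/
theorem stmt3 (δ β χ : ℝ) (hδ : 0 < δ) (hβ : 0 < β) (hχ : 0 ≤ χ) (hχ' : χ ≤ 1) :
    (∀ w l θ φ : ℝ, 0 < w → w ≤ 1 / 2 → 0 ≤ l → l ≤ 1 →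
      0 ≤ θ → θ ≤ π → 0 ≤ φ → φ < 2 * π → Real.sin θ = χ →
      fisherInfo δ β w l θ φ ≤
        2 * δ ^ 2 * (1 - χ ^ 2) /
          (4 - χ ^ 2 + 4 * Real.cosh (β * δ) + χ ^ 2 * Real.cosh (2 * β * δ)))
    ∧ (∀ θ φ : ℝ, 0 ≤ θ → θ ≤ π → 0 ≤ φ → φ < 2 * π →
        Real.sin θ = χ → Real.cos θ = Real.sqrt (1 - χ ^ 2) →
      fisherInfo δ β (1 / 2) 1 θ φ =
        2 * δ ^ 2 * (1 - χ ^ 2) /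
          (4 - χ ^ 2 + 4 * Real.cosh (β * δ) + χ ^ 2 * Real.cosh (2 * β * δ))) := by
  refine ⟨fun w l θ φ hw hw' hl hl' _ _ _ _ hθ => ?_, fun θ φ _ _ _ _ hθ _ => ?_⟩
  · rw [fisherInfo_eq δ β w l θ φ hw.ne', fisher_bound_eq]
    refine mul_le_mul_of_nonneg_left (binary_ratio_le hw hw' ?_ ?_ (Real.tanh_sq_lt_one _))
      (by positivity)
    · rw [← hθ, ← Real.cos_sq', mul_pow]
      exact mul_le_of_le_one_left (sq_nonneg _) (pow_le_one₀ hl hl')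
    · linarith [sq_nonneg χ]
  · rw [fisherInfo_eq δ β (1 / 2) 1 θ φ (by norm_num), fisher_bound_eq, ← hθ, ← Real.cos_sq',
      one_mul, ← mul_div_mul_left (Real.cos θ ^ 2) _ (by norm_num : (1 / 2 : ℝ) ≠ 0)]
    congr 2
    ring
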